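/- arXiv:2102.05168 — 2 statements merged into one kernel-verified Lean document; each statement's English description precedes it below -/
import Mathlib

section
/- There is a universal constant C such that for every weighted graph G=(V,E,w) on n ≥ 2 vertices with root r ∈ V and every ε ∈ (0,1), there exists an online algorithm for online f-partial group Steiner tree on G that is (1−ε)-connection-competitive and whose cost satisfies, for every request sequence and every t, w(H_t) ≤ C·(log³n/ε)·(max_{i≤t} |g_i|/f_i)·OPT_t. -/
/-- An edge set `F` connects vertices `u` and `v` if they lie in the same connected
component of the graph with edge set `F`. -/
def EdgeConn {V : Type*} (F : Set (Sym2 V)) (u v : V) : Prop :=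
  (SimpleGraph.fromEdgeSet F).Reachable u v

/-- The number of vertices of the group `g` that the edge set `H` connects to `r`. -/
noncomputable def connVerts {V : Type*} (r : V) (H : Finset (Sym2 V)) (g : Set V) : ℕ :=
  {v ∈ g | EdgeConn (↑H) v r}.ncard

/-- An `f`-partial group Steiner tree request sequence `(g₁,f₁),…,(g_t,f_t)` is valid
when `1 ≤ fᵢ ≤ |gᵢ|` for every `i`. -/
def ValidFP {V : Type*} (l : List (Set V × ℕ)) : Prop :=
  ∀ q ∈ l, 1 ≤ q.2 ∧ q.2 ≤ q.1.ncard

theorem EdgeConn.refl {V : Type*} (F : Set (Sym2 V)) (u : V) : EdgeConn F u u :=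
  SimpleGraph.Reachable.refl u

theorem EdgeConn.symm {V : Type*} {F : Set (Sym2 V)} {u v : V} (h : EdgeConn F u v) :
    EdgeConn F v u :=
  SimpleGraph.Reachable.symm h

theorem EdgeConn.trans {V : Type*} {F : Set (Sym2 V)} {u v z : V} (h : EdgeConn F u v)
    (h' : EdgeConn F v z) : EdgeConn F u z :=
  SimpleGraph.Reachable.trans h h'

theorem EdgeConn.mono {V : Type*} {F F' : Set (Sym2 V)} (hF : F ⊆ F') {u v : V}
    (h : EdgeConn F u v) : EdgeConn F' u v :=
  SimpleGraph.Reachable.mono (SimpleGraph.fromEdgeSet_mono hF) h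

theorem EdgeConn.of_mem {V : Type*} {F : Set (Sym2 V)} {u v : V} (h : s(u, v) ∈ F) :
    EdgeConn F u v := by
  by_cases huv : u = v
  · exact huv ▸ EdgeConn.refl F u
  · exact SimpleGraph.Adj.reachable ((SimpleGraph.fromEdgeSet_adj F).2 ⟨h, huv⟩)

theorem connVerts_mono {V : Type*} [Finite V] (r : V) {H H' : Finset (Sym2 V)} (h : H ⊆ H')
    (g : Set V) : connVerts r H g ≤ connVerts r H' g :=
  Set.ncard_le_ncard (fun _ hv => ⟨hv.1, hv.2.mono (Finset.coe_subset.2 h)⟩) (Set.toFinite _)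

/-- The variation of a vertex function along an edge. -/
def edgeDiff {V : Type*} (φ : V → ℝ) : Sym2 V → ℝ :=
  Sym2.lift ⟨fun u v => |φ u - φ v|, fun _ _ => abs_sub_comm _ _⟩

@[simp] theorem edgeDiff_mk {V : Type*} (φ : V → ℝ) (u v : V) :
    edgeDiff φ s(u, v) = |φ u - φ v| := rfl

theorem edgeDiff_nonneg {V : Type*} (φ : V → ℝ) (e : Sym2 V) : 0 ≤ edgeDiff φ e := by
  induction e with
  | _ u v => exact abs_nonneg _

/-- A vertex function varies along a connecting edge set at least as much as between the
two connected vertices. -/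
theorem EdgeConn.abs_sub_le_sum_edgeDiff {V : Type*} {F : Finset (Sym2 V)} {u v : V}
    (h : EdgeConn (↑F) u v) (φ : V → ℝ) : |φ u - φ v| ≤ ∑ e ∈ F, edgeDiff φ e := by
  classical
  obtain ⟨p, hp⟩ := SimpleGraph.Reachable.exists_isPath h
  have key : ∀ {a b : V} (q : (SimpleGraph.fromEdgeSet (F : Set (Sym2 V))).Walk a b),
      |φ a - φ b| ≤ (q.edges.map (edgeDiff φ)).sum := by
    intro a b q
    induction q with
    | nil => simp
    | @cons a c b hac q ih =>
      simp only [SimpleGraph.Walk.edges_cons, List.map_cons, List.sum_cons, edgeDiff_mk]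
      exact (abs_sub_le _ (φ c) _).trans (by linarith)
  refine (key p).trans ?_
  rw [← List.sum_toFinset _ hp.isTrail.edges_nodup]
  refine Finset.sum_le_sum_of_subset_of_nonneg (fun e he => ?_)
    fun e _ _ => edgeDiff_nonneg φ e
  have := p.edges_subset_edgeSet (List.mem_toFinset.1 he)
  rw [SimpleGraph.edgeSet_fromEdgeSet] at this
  exact this.1

/-- The least weight of an edge set within `E` connecting two vertices. -/
noncomputable def edgeDist {V : Type*} (E : Finset (Sym2 V)) (w : Sym2 V → ℝ) (u v : V) : ℝ :=
  sInf {c | ∃ F ⊆ E, EdgeConn (↑F) u v ∧ ∑ e ∈ F, w e = c}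

theorem finite_connecting_weights {V : Type*} (E : Finset (Sym2 V)) (w : Sym2 V → ℝ) (u v : V) :
    {c | ∃ F ⊆ E, EdgeConn (↑F) u v ∧ ∑ e ∈ F, w e = c}.Finite := by
  refine ((E.powerset.finite_toSet).image fun F => ∑ e ∈ F, w e).subset ?_
  rintro c ⟨F, hF, -, rfl⟩
  exact ⟨F, by simpa using hF, rfl⟩

theorem edgeDist_le {V : Type*} {E F : Finset (Sym2 V)} (w : Sym2 V → ℝ) {u v : V}
    (hF : F ⊆ E) (h : EdgeConn (↑F) u v) : edgeDist E w u v ≤ ∑ e ∈ F, w e :=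
  csInf_le (finite_connecting_weights E w u v).bddBelow ⟨F, hF, h, rfl⟩

theorem exists_edgeDist_eq {V : Type*} {E : Finset (Sym2 V)} (w : Sym2 V → ℝ) {u v : V}
    (h : EdgeConn (↑E) u v) :
    ∃ F ⊆ E, EdgeConn (↑F) u v ∧ ∑ e ∈ F, w e = edgeDist E w u v := by
  have hne : {c | ∃ F ⊆ E, EdgeConn (↑F) u v ∧ ∑ e ∈ F, w e = c}.Nonempty :=
    ⟨_, E, subset_rfl, h, rfl⟩
  exact hne.csInf_mem (finite_connecting_weights E w u v)

theorem edgeDist_comm {V : Type*} (E : Finset (Sym2 V)) (w : Sym2 V → ℝ) (u v : V) :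
    edgeDist E w u v = edgeDist E w v u := by
  unfold edgeDist
  congr 1
  ext c
  exact ⟨fun ⟨F, a, b, d⟩ => ⟨F, a, b.symm, d⟩, fun ⟨F, a, b, d⟩ => ⟨F, a, b.symm, d⟩⟩

theorem edgeDist_nonneg {V : Type*} {E : Finset (Sym2 V)} {w : Sym2 V → ℝ}
    (hw : ∀ e ∈ E, 0 ≤ w e) (u v : V) : 0 ≤ edgeDist E w u v := by
  refine Real.sInf_nonneg ?_
  rintro c ⟨F, hF, -, rfl⟩
  exact Finset.sum_nonneg fun e he => hw e (hF he)

theorem edgeDist_self {V : Type*} {E : Finset (Sym2 V)} {w : Sym2 V → ℝ}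
    (hw : ∀ e ∈ E, 0 ≤ w e) (u : V) : edgeDist E w u u = 0 :=
  le_antisymm (by simpa using edgeDist_le w (Finset.empty_subset E) (EdgeConn.refl _ u))
    (edgeDist_nonneg hw u u)

theorem edgeDist_triangle {V : Type*} {E : Finset (Sym2 V)} {w : Sym2 V → ℝ}
    (hw : ∀ e ∈ E, 0 ≤ w e) (hE : ∀ u v : V, EdgeConn (↑E) u v) (u v z : V) :
    edgeDist E w u z ≤ edgeDist E w u v + edgeDist E w v z := by
  classical
  obtain ⟨F, hF, hc, hs⟩ := exists_edgeDist_eq w (hE u v)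
  obtain ⟨F', hF', hc', hs'⟩ := exists_edgeDist_eq w (hE v z)
  rw [← hs, ← hs', ← Finset.sum_union_inter]
  have h1 := edgeDist_le (u := u) (v := z) w (Finset.union_subset hF hF')
    ((hc.mono (by simp)).trans (hc'.mono (by simp)))
  have h2 : 0 ≤ ∑ e ∈ F ∩ F', w e :=
    Finset.sum_nonneg fun e he => hw e (hF (Finset.mem_inter.1 he).1)
  linarith

/-- The cone function of height `ρ` centred at `v`. -/
noncomputable def bump {V : Type*} (E : Finset (Sym2 V)) (w : Sym2 V → ℝ) (ρ : ℝ) (v u : V) : ℝ :=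
  max 0 (ρ - edgeDist E w v u)

theorem edgeDiff_bump_le_weight {V : Type*} {E : Finset (Sym2 V)} {w : Sym2 V → ℝ}
    (hw : ∀ e ∈ E, 0 ≤ w e) (hE : ∀ u v : V, EdgeConn (↑E) u v) (ρ : ℝ) (v : V) {e : Sym2 V}
    (he : e ∈ E) : edgeDiff (bump E w ρ v) e ≤ w e := by
  induction e with
  | _ a b =>
    have hab : edgeDist E w a b ≤ w s(a, b) := by
      simpa using edgeDist_le (F := {s(a, b)}) (u := a) (v := b) w (by simpa using he)
        (EdgeConn.of_mem (by simp))
    have h1 := edgeDist_triangle hw hE v a b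
    have h2 := edgeDist_triangle hw hE v b a
    rw [edgeDist_comm E w b a] at h2
    simp only [edgeDiff_mk, bump]
    rw [max_comm, max_comm 0]
    refine (abs_max_sub_max_le_abs _ _ _).trans ?_
    rw [abs_le]
    constructor <;> linarith

theorem edgeDiff_bump_le_height {V : Type*} {E : Finset (Sym2 V)} {w : Sym2 V → ℝ}
    (hw : ∀ e ∈ E, 0 ≤ w e) {ρ : ℝ} (hρ : 0 ≤ ρ) (v : V) (e : Sym2 V) :
    edgeDiff (bump E w ρ v) e ≤ ρ := by
  induction e with
  | _ a b =>
    have h1 := edgeDist_nonneg hw v a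
    have h2 := edgeDist_nonneg hw v b
    simp only [edgeDiff_mk, bump, abs_le]
    constructor <;> rcases max_cases 0 (ρ - edgeDist E w v a) with h | h <;>
      rcases max_cases 0 (ρ - edgeDist E w v b) with h' | h' <;> linarith

/-- Cones with height `ρ` whose centres are `2ρ`-separated have total variation at most twice
the weight along every edge. -/
theorem sum_edgeDiff_bump_le {V : Type*} {E : Finset (Sym2 V)} {w : Sym2 V → ℝ}
    (hw : ∀ e ∈ E, 0 ≤ w e) (hE : ∀ u v : V, EdgeConn (↑E) u v) (ρ : ℝ) (Q : Finset V)
    (hQ : ∀ p ∈ Q, ∀ q ∈ Q, p ≠ q → 2 * ρ ≤ edgeDist E w p q) {e : Sym2 V} (he : e ∈ E) :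
    ∑ p ∈ Q, edgeDiff (bump E w ρ p) e ≤ 2 * w e := by
  classical
  have hone : ∀ u : V, ((Q.filter fun p => edgeDist E w p u < ρ).card : ℝ) ≤ 1 := by
    intro u
    have : (Q.filter fun p => edgeDist E w p u < ρ).card ≤ 1 := by
      refine Finset.card_le_one.2 fun p hp q hq => ?_
      by_contra hpq
      rw [Finset.mem_filter] at hp hq
      have h1 := hQ p hp.1 q hq.1 hpq
      have h2 := edgeDist_triangle hw hE p u q
      rw [edgeDist_comm E w u q] at h2
      linarith [hp.2, hq.2]
    exact_mod_cast this
  have hle := hw e he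
  have hwt := fun p => edgeDiff_bump_le_weight hw hE ρ p he
  induction e with
  | _ a b =>
    have hterm : ∀ p ∈ Q, edgeDiff (bump E w ρ p) s(a, b) ≤
        w s(a, b) * (if edgeDist E w p a < ρ then 1 else 0) +
          w s(a, b) * (if edgeDist E w p b < ρ then 1 else 0) := by
      intro p _
      have := hwt p
      split_ifs with h1 h2 h2
      · linarith
      · linarith
      · linarith
      · simp only [edgeDiff_mk, bump]
        rw [max_eq_left (by linarith), max_eq_left (by linarith)]
        simp
    refine (Finset.sum_le_sum hterm).trans ?_
    rw [Finset.sum_add_distrib, ← Finset.mul_sum, ← Finset.mul_sum, Finset.sum_boole,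
      Finset.sum_boole]
    nlinarith [hone a, hone b]

/-- A multiplicative update of a fractional edge set `x` for a covering constraint with
coefficients `a` and right-hand side `b` that is violated by a factor of two. -/
theorem exists_multiplicative_update {α : Type*} (E : Finset α) {w x a : α → ℝ} {n b δ : ℝ}
    (hn : 1 ≤ n) (hδ : 0 < δ) (hδ1 : δ ≤ 1) (hw : ∀ e ∈ E, 1 ≤ w e)
    (hx : ∀ e, 0 ≤ x e) (hx4 : ∀ e, x e + δ ≤ 4) (ha0 : ∀ e, 0 ≤ a e) (han : ∀ e, a e ≤ n)
    (hax : ∑ e ∈ E, a e * x e ≤ b / 2) (had : δ * ∑ e ∈ E, a e ≤ b / 2) :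
    ∃ x' : α → ℝ, (∀ e, x e ≤ x' e) ∧ (∀ e, x' e + δ ≤ 4) ∧
      ∑ e ∈ E, w e * x' e - ∑ e ∈ E, w e * x e ≤ b / n ∧
      ∀ F ⊆ E, b ≤ ∑ e ∈ F, a e → b / (4 * n) ≤
        ∑ e ∈ F, w e * Real.log ((x' e + δ) / δ) - ∑ e ∈ F, w e * Real.log ((x e + δ) / δ) := by
  classical
  have hn0 : 0 < n := by linarith
  have ht0 : ∀ e ∈ E, 0 ≤ a e / (n * w e) := fun e he =>
    div_nonneg (ha0 e) (mul_nonneg hn0.le (by linarith [hw e he]))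
  have ht1 : ∀ e ∈ E, a e / (n * w e) ≤ 1 := fun e he => by
    have h1 := hw e he
    rw [div_le_one (by positivity)]
    nlinarith [han e]
  have hwt : ∀ e ∈ E, w e * (a e / (n * w e)) = a e / n := fun e he => by
    have h1 := hw e he
    field_simp
  refine ⟨fun e => if e ∈ E ∧ x e < 1 then x e + (x e + δ) * (a e / (n * w e)) else x e,
    fun e => ?_, fun e => ?_, ?_, fun F hF hb => ?_⟩
  · dsimp only
    split_ifs with h
    · have := mul_nonneg (add_nonneg (hx e) hδ.le) (ht0 e h.1)
      linarith
    · exact le_rfl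
  · dsimp only
    split_ifs with h
    · have := ht1 e h.1
      have := hx e
      nlinarith [h.2]
    · exact hx4 e
  · have hterm : ∀ e ∈ E, w e * (if e ∈ E ∧ x e < 1 then x e + (x e + δ) * (a e / (n * w e))
        else x e) - w e * x e ≤ (a e * x e + δ * a e) / n := by
      intro e he
      have := hwt e he
      split_ifs with h
      · have h2 : w e * (x e + (x e + δ) * (a e / (n * w e))) - w e * x e =
            (x e + δ) * (w e * (a e / (n * w e))) := by ring
        rw [h2, this]
        exact le_of_eq (by ring)
      · have := mul_nonneg (ha0 e) (hx e)
        have := mul_nonneg hδ.le (ha0 e)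
        rw [sub_self]
        positivity
    rw [← Finset.sum_sub_distrib]
    refine (Finset.sum_le_sum hterm).trans ?_
    rw [← Finset.sum_div, Finset.sum_add_distrib, ← Finset.mul_sum]
    gcongr
    linarith
  · have hterm : ∀ e ∈ F, (a e - a e * x e) / (2 * n) ≤
        w e * Real.log (((if e ∈ E ∧ x e < 1 then x e + (x e + δ) * (a e / (n * w e))
          else x e) + δ) / δ) - w e * Real.log ((x e + δ) / δ) := by
      intro e heF
      have he := hF heF
      have hx0 := hx e
      split_ifs with h
      · have h2 : (x e + (x e + δ) * (a e / (n * w e)) + δ) / δ =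
            (x e + δ) / δ * (1 + a e / (n * w e)) := by ring
        have h3 := ht0 e he
        have h4 : a e / (n * w e) / 2 ≤ Real.log (1 + a e / (n * w e)) := by
          refine le_trans ?_ (Real.le_log_one_add_of_nonneg h3)
          rw [div_le_div_iff₀ (by norm_num) (by linarith)]
          nlinarith [ht1 e he]
        rw [h2, Real.log_mul (by positivity) (by positivity), mul_add, add_sub_cancel_left]
        have h5 := mul_le_mul_of_nonneg_left h4 (by linarith [hw e he] : 0 ≤ w e)
        have h6 : w e * (a e / (n * w e) / 2) = a e / (2 * n) := by
          rw [← mul_div_assoc, hwt e he]; field_simp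
        rw [h6] at h5
        refine le_trans ?_ h5
        gcongr
        linarith [mul_nonneg (ha0 e) hx0]
      · rw [sub_self]
        refine div_nonpos_of_nonpos_of_nonneg ?_ (by positivity)
        have h1 : 1 ≤ x e := by
          by_contra h1
          exact h ⟨he, not_le.1 h1⟩
        nlinarith [ha0 e]
    rw [← Finset.sum_sub_distrib]
    refine le_trans ?_ (Finset.sum_le_sum hterm)
    rw [← Finset.sum_div, Finset.sum_sub_distrib, div_le_div_iff₀ (by positivity) (by positivity)]
    have hle : ∑ e ∈ F, a e * x e ≤ ∑ e ∈ E, a e * x e :=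
      Finset.sum_le_sum_of_subset_of_nonneg hF fun e _ _ => mul_nonneg (ha0 e) (hx e)
    nlinarith

/-- A weak-type bound on the level sets of `c` gives a harmonic bound on its sum. -/
theorem sum_le_mul_harmonic {α : Type*} (P : Finset α) (c : α → ℝ) {K : ℝ} (hK : 0 ≤ K)
    (h : ∀ Q ⊆ P, ∀ d : ℝ, 0 < d → (∀ p ∈ Q, d ≤ c p) → (Q.card : ℝ) * d ≤ K) :
    ∑ p ∈ P, c p ≤ K * harmonic P.card := by
  classical
  induction hm : P.card generalizing P with
  | zero => simp [Finset.card_eq_zero.1 hm]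
  | succ m ih =>
    obtain ⟨p, hp, hmin⟩ := P.exists_min_image c (Finset.card_pos.1 (by omega))
    have h1 := ih (P.erase p) (fun Q hQ => h Q (hQ.trans (P.erase_subset p)))
      (by rw [Finset.card_erase_of_mem hp, hm]; rfl)
    have h2 : c p ≤ K * ((m : ℝ) + 1)⁻¹ := by
      rcases le_or_gt (c p) 0 with h0 | h0
      · exact h0.trans (by positivity)
      · have := h P subset_rfl (c p) h0 hmin
        rw [hm] at this
        push_cast at this
        rw [← div_eq_mul_inv, le_div_iff₀ (by positivity)]
        linarith
    rw [← Finset.add_sum_erase P c hp, harmonic_succ]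
    push_cast
    linarith

/-- There is a cheapest edge set attaching `v` to the component of `r`. -/
theorem exists_cheapest_attachment {V : Type*} {E : Finset (Sym2 V)} (w : Sym2 V → ℝ)
    (hE : ∀ u v : V, EdgeConn (↑E) u v) (H : Finset (Sym2 V)) (r v : V) :
    ∃ F : Finset (Sym2 V), F ⊆ E ∧ EdgeConn (↑H ∪ ↑F) v r ∧
      ∀ u, EdgeConn (↑H) u r → ∑ e ∈ F, w e ≤ edgeDist E w v u := by
  classical
  obtain ⟨F, hF, hmin⟩ := (E.powerset.filter fun F : Finset (Sym2 V) =>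
    EdgeConn ((H : Set (Sym2 V)) ∪ (F : Set (Sym2 V))) v r).exists_min_image
      (fun F => ∑ e ∈ F, w e)
      ⟨E, by simpa using (hE v r).mono Set.subset_union_right⟩
  rw [Finset.mem_filter, Finset.mem_powerset] at hF
  refine ⟨F, hF.1, hF.2, fun u hu => ?_⟩
  obtain ⟨F', hF', hc, hs⟩ := exists_edgeDist_eq w (hE v u)
  rw [← hs]
  refine hmin F' (Finset.mem_filter.2 ⟨Finset.mem_powerset.2 hF', ?_⟩)
  exact (hc.mono Set.subset_union_right).trans (hu.mono Set.subset_union_left)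

/-- The state of the online algorithm: the edges bought so far, a fractional edge set, the
vertices that were attached explicitly, and the cost of attaching each of them. -/
structure GreedyState (V : Type*) where
  edges : Finset (Sym2 V)
  frac : Sym2 V → ℝ
  bought : Finset V
  cost : V → ℝ

/-- The invariants of the online algorithm, where `Feas` describes the offline solutions that are
still feasible and `R` bounds the ratios `|gᵢ|/fᵢ`. -/
structure GreedyState.Invariant {V : Type*} (E : Finset (Sym2 V)) (w : Sym2 V → ℝ) (r : V)
    (ε δ R : ℝ) (Feas : Finset (Sym2 V) → Prop) (s : GreedyState V) : Prop where
  edges_subset : s.edges ⊆ E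
  frac_nonneg : ∀ e, 0 ≤ s.frac e
  frac_le : ∀ e, s.frac e + δ ≤ 4
  frac_cost : ∀ F ⊆ E, Feas F → ∑ e ∈ E, w e * s.frac e ≤
    4 * ∑ e ∈ F, w e * Real.log ((s.frac e + δ) / δ)
  conn : ∀ p ∈ s.bought, EdgeConn (↑s.edges) p r
  edges_cost : ∑ e ∈ s.edges, w e ≤ ∑ p ∈ s.bought, s.cost p
  separated : ∀ p ∈ s.bought, ∀ q ∈ s.bought, p ≠ q →
    min (s.cost p) (s.cost q) ≤ edgeDist E w p q
  dense : ∀ p ∈ s.bought, ∀ ρ : ℝ, 0 < ρ → 2 * ρ ≤ s.cost p →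
    ε * ρ ≤ 2 * R * ∑ e ∈ E, s.frac e * edgeDiff (bump E w ρ p) e

theorem GreedyState.Invariant.mono {V : Type*} {E : Finset (Sym2 V)} {w : Sym2 V → ℝ} {r : V}
    {ε δ R R' : ℝ} {Feas Feas' : Finset (Sym2 V) → Prop} {s : GreedyState V}
    (h : s.Invariant E w r ε δ R Feas) (hR : R ≤ R') (hFeas : ∀ F, Feas' F → Feas F) :
    s.Invariant E w r ε δ R' Feas' where
  edges_subset := h.edges_subset
  frac_nonneg := h.frac_nonneg
  frac_le := h.frac_le
  frac_cost F hF hf := h.frac_cost F hF (hFeas F hf)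
  conn := h.conn
  edges_cost := h.edges_cost
  separated := h.separated
  dense p hp ρ h0 h1 := by
    refine (h.dense p hp ρ h0 h1).trans ?_
    have : 0 ≤ ∑ e ∈ E, s.frac e * edgeDiff (bump E w ρ p) e :=
      Finset.sum_nonneg fun e _ => mul_nonneg (h.frac_nonneg e) (edgeDiff_nonneg _ e)
    gcongr

/-- Attaching a vertex around which the fractional solution is dense preserves the invariants. -/
theorem GreedyState.Invariant.exists_attach {V : Type*} {E : Finset (Sym2 V)} {w : Sym2 V → ℝ}
    {r : V} {ε δ R : ℝ} {Feas : Finset (Sym2 V) → Prop} {s : GreedyState V}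
    (h : s.Invariant E w r ε δ R Feas) (hw : ∀ e ∈ E, 0 ≤ w e) {v : V}
    (hv : ¬EdgeConn (↑s.edges) v r) {F : Finset (Sym2 V)} (hFE : F ⊆ E)
    (hF : EdgeConn (↑s.edges ∪ ↑F) v r)
    (hmin : ∀ u, EdgeConn (↑s.edges) u r → ∑ e ∈ F, w e ≤ edgeDist E w v u)
    (hdense : ∀ ρ : ℝ, 0 < ρ → 2 * ρ ≤ ∑ e ∈ F, w e →
      ε * ρ ≤ 2 * R * ∑ e ∈ E, s.frac e * edgeDiff (bump E w ρ v) e) :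
    ∃ s' : GreedyState V, s'.Invariant E w r ε δ R Feas ∧ s.edges ⊆ s'.edges ∧
      s'.frac = s.frac ∧ s'.bought.card = s.bought.card + 1 := by
  classical
  have hvb : v ∉ s.bought := fun hm => hv (h.conn v hm)
  have hne : ∀ p ∈ s.bought, p ≠ v := fun p hp hpv => hvb (hpv ▸ hp)
  refine ⟨⟨s.edges ∪ F, s.frac, insert v s.bought,
    Function.update s.cost v (∑ e ∈ F, w e)⟩, ?_, Finset.subset_union_left, rfl,
    Finset.card_insert_of_notMem hvb⟩
  refine ⟨Finset.union_subset h.edges_subset hFE, h.frac_nonneg, h.frac_le, h.frac_cost,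
    ?_, ?_, ?_, ?_⟩
  · intro p hp
    rcases Finset.mem_insert.1 hp with rfl | hp
    · simpa using hF
    · exact (h.conn p hp).mono (by simp)
  · dsimp only
    rw [Finset.sum_insert hvb, Function.update_self]
    have h1 : ∑ p ∈ s.bought, Function.update s.cost v (∑ e ∈ F, w e) p =
        ∑ p ∈ s.bought, s.cost p :=
      Finset.sum_congr rfl fun p hp => Function.update_of_ne (hne p hp) _ _
    have h2 := Finset.sum_union_inter (s₁ := s.edges) (s₂ := F) (f := w)
    have h3 : 0 ≤ ∑ e ∈ s.edges ∩ F, w e :=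
      Finset.sum_nonneg fun e he => hw e (hFE (Finset.mem_inter.1 he).2)
    have := h.edges_cost
    linarith
  · intro p hp q hq hpq
    dsimp only
    rcases Finset.mem_insert.1 hp with rfl | hp' <;> rcases Finset.mem_insert.1 hq with rfl | hq'
    · exact absurd rfl hpq
    · rw [Function.update_self]
      exact (min_le_left _ _).trans (hmin q (h.conn q hq'))
    · rw [Function.update_self, edgeDist_comm]
      exact (min_le_right _ _).trans (hmin p (h.conn p hp'))
    · rw [Function.update_of_ne (hne p hp'), Function.update_of_ne (hne q hq')]
      exact h.separated p hp' q hq' hpq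
  · intro p hp ρ h0
    dsimp only
    rcases Finset.mem_insert.1 hp with rfl | hp
    · rw [Function.update_self]
      exact hdense ρ h0
    · rw [Function.update_of_ne (hne p hp)]
      exact h.dense p hp ρ h0

/-- If the fractional solution is sparse around every unconnected vertex of a group, then it can
be increased while preserving the invariants. -/
theorem GreedyState.Invariant.exists_increase {V : Type*} [Fintype V] {E : Finset (Sym2 V)}
    {w : Sym2 V → ℝ} {r : V} {ε δ R : ℝ} {Feas : Finset (Sym2 V) → Prop} {s : GreedyState V}
    (h : s.Invariant E w r ε δ R Feas) (hw : ∀ e ∈ E, 1 ≤ w e)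
    (hE : ∀ u v : V, EdgeConn (↑E) u v) (hδ : 0 < δ)
    (hδ1 : δ ≤ 1) (hδE : δ * (E.card * Fintype.card V) ≤ 1 / 2) {g : Set V} {f : ℕ} (hf : 1 ≤ f)
    (hfg : f ≤ g.ncard) (hR : (g.ncard : ℝ) ≤ R * f) (hR0 : 0 < R) (hε : 0 < ε)
    (hfeas : ∀ F, Feas F → f ≤ connVerts r F g)
    (hunsat : (connVerts r s.edges g : ℝ) < (1 - ε) * f) {d : V → ℝ}
    (hd : ∀ v, d v ≤ edgeDist E w v r) {ρ : V → ℝ}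
    (hρ : ∀ v ∈ g, ¬EdgeConn (↑s.edges) v r → 0 < ρ v ∧ 2 * ρ v ≤ d v ∧
      2 * R * ∑ e ∈ E, s.frac e * edgeDiff (bump E w (ρ v) v) e < ε * ρ v) :
    ∃ s' : GreedyState V, s'.Invariant E w r ε δ R Feas ∧ s.edges ⊆ s'.edges ∧
      s'.bought = s.bought ∧ 1 / (4 * (Fintype.card V : ℝ)) ≤
        ∑ e ∈ E, w e * Real.log ((s'.frac e + δ) / δ) -
          ∑ e ∈ E, w e * Real.log ((s.frac e + δ) / δ) := by
  classical
  have hw0 : ∀ e ∈ E, 0 ≤ w e := fun e he => zero_le_one.trans (hw e he)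
  set A : Finset V := Finset.univ.filter fun v => v ∈ g ∧ ¬EdgeConn (↑s.edges) v r with hA
  have hρA : ∀ v ∈ A, 0 < ρ v ∧ 2 * ρ v ≤ d v ∧
      2 * R * ∑ e ∈ E, s.frac e * edgeDiff (bump E w (ρ v) v) e < ε * ρ v := fun v hv => by
    rw [hA, Finset.mem_filter] at hv
    exact hρ v hv.2.1 hv.2.2
  have hAn : (A.card : ℝ) ≤ Fintype.card V := by exact_mod_cast A.card_le_univ
  have hAg : (A.card : ℝ) ≤ g.ncard := by
    rw [← Set.ncard_coe_finset]
    have hsub : (A : Set V) ⊆ g := fun v hv => by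
      simp only [hA, Finset.coe_filter, Finset.mem_univ, true_and, Set.mem_ofPred_eq] at hv
      exact hv.1
    exact_mod_cast Set.ncard_le_ncard hsub (Set.toFinite g)
  have hn1 : (1 : ℝ) ≤ Fintype.card V := by
    have : Nonempty V := ⟨r⟩
    exact_mod_cast Fintype.card_pos
  set b : ℝ := f - connVerts r s.edges g with hb
  have hεb : ε * f ≤ b := by rw [hb]; linarith
  have hb1 : 1 ≤ b := by
    have h1 : (connVerts r s.edges g : ℝ) < f := by
      have : 0 < ε * f := by positivity
      linarith
    have h2 : connVerts r s.edges g + 1 ≤ f := by exact_mod_cast h1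
    have h3 : (connVerts r s.edges g : ℝ) + 1 ≤ f := by exact_mod_cast h2
    rw [hb]; linarith
  set a : Sym2 V → ℝ := fun e => ∑ v ∈ A, edgeDiff (bump E w (ρ v) v) e / ρ v with ha
  have ha0 : ∀ e, 0 ≤ a e := fun e => Finset.sum_nonneg fun v hv =>
    div_nonneg (edgeDiff_nonneg _ e) (hρA v hv).1.le
  have han : ∀ e, a e ≤ Fintype.card V := fun e => by
    refine le_trans ?_ hAn
    rw [← nsmul_one A.card]
    refine Finset.sum_le_card_nsmul A _ 1 fun v hv => ?_
    rw [div_le_one (hρA v hv).1]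
    exact edgeDiff_bump_le_height hw0 (hρA v hv).1.le v e
  have hax : ∑ e ∈ E, a e * s.frac e ≤ b / 2 := by
    have h1 : ∑ e ∈ E, a e * s.frac e =
        ∑ v ∈ A, (∑ e ∈ E, s.frac e * edgeDiff (bump E w (ρ v) v) e) / ρ v := by
      simp only [ha, Finset.sum_mul, Finset.sum_div]
      rw [Finset.sum_comm]
      refine Finset.sum_congr rfl fun v _ => Finset.sum_congr rfl fun e _ => by ring
    have h2 : ∀ v ∈ A, (∑ e ∈ E, s.frac e * edgeDiff (bump E w (ρ v) v) e) / ρ v ≤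
        ε / (2 * R) := fun v hv => by
      obtain ⟨h3, -, h4⟩ := hρA v hv
      rw [div_le_div_iff₀ h3 (by positivity)]
      linarith
    rw [h1]
    refine (Finset.sum_le_card_nsmul A _ _ h2).trans ?_
    rw [nsmul_eq_mul, ← mul_div_assoc, div_le_div_iff₀ (by positivity) (by norm_num)]
    have h5 : (A.card : ℝ) * ε ≤ R * f * ε := by gcongr; exact hAg.trans hR
    have h6 : R * (ε * f) ≤ R * b := by gcongr
    linarith
  have had : δ * ∑ e ∈ E, a e ≤ b / 2 := by
    have h1 : ∑ e ∈ E, a e ≤ E.card * Fintype.card V := by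
      rw [← nsmul_eq_mul]
      exact Finset.sum_le_card_nsmul E _ _ fun e _ => han e
    have h2 := mul_le_mul_of_nonneg_left h1 hδ.le
    linarith
  have hcover : ∀ F : Finset (Sym2 V), f ≤ connVerts r F g → b ≤ ∑ e ∈ F, a e := by
    intro F hF
    set B : Finset V := A.filter fun v => EdgeConn (↑F) v r with hB
    have h1 : connVerts r F g ≤ B.card + connVerts r s.edges g := by
      rw [← Set.ncard_coe_finset]
      refine le_trans (Set.ncard_le_ncard ?_ (Set.toFinite _)) (Set.ncard_union_le _ _)
      intro v hv
      by_cases hc : EdgeConn (↑s.edges) v r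
      · exact Or.inr ⟨hv.1, hc⟩
      · exact Or.inl (by simp [hB, hA, hv.1, hc, hv.2])
    have h2 : (f : ℝ) ≤ B.card + connVerts r s.edges g := by exact_mod_cast hF.trans h1
    have h3 : ∑ e ∈ F, a e = ∑ v ∈ A, (∑ e ∈ F, edgeDiff (bump E w (ρ v) v) e) / ρ v := by
      simp only [ha, Finset.sum_div]
      exact Finset.sum_comm
    have h4 : (B.card : ℝ) ≤ ∑ v ∈ B, (∑ e ∈ F, edgeDiff (bump E w (ρ v) v) e) / ρ v := by
      rw [← nsmul_one B.card]
      refine Finset.card_nsmul_le_sum B _ 1 fun v hv => ?_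
      rw [hB, Finset.mem_filter] at hv
      obtain ⟨h5, h6, -⟩ := hρA v hv.1
      have h7 := hv.2.abs_sub_le_sum_edgeDiff (bump E w (ρ v) v)
      have h8 : bump E w (ρ v) v v = ρ v := by
        rw [bump, edgeDist_self hw0, sub_zero, max_eq_right h5.le]
      have h9 : bump E w (ρ v) v r = 0 := by
        rw [bump, max_eq_left]
        linarith [hd v]
      rw [h8, h9, sub_zero, abs_of_pos h5] at h7
      rwa [one_le_div h5]
    have h5 : ∑ v ∈ B, (∑ e ∈ F, edgeDiff (bump E w (ρ v) v) e) / ρ v ≤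
        ∑ v ∈ A, (∑ e ∈ F, edgeDiff (bump E w (ρ v) v) e) / ρ v :=
      Finset.sum_le_sum_of_subset_of_nonneg (Finset.filter_subset _ _) fun v hv _ =>
        div_nonneg (Finset.sum_nonneg fun e _ => edgeDiff_nonneg _ e) (hρA v hv).1.le
    rw [h3, hb]
    linarith
  have hfE : f ≤ connVerts r E g := by
    have : connVerts r E g = g.ncard := by
      unfold connVerts
      congr 1
      ext v
      simp [hE v r]
    rwa [this]
  obtain ⟨x', hxx', hx4, hcost, hpot⟩ := exists_multiplicative_update E hn1 hδ hδ1 hw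
    h.frac_nonneg h.frac_le ha0 han hax had
  refine ⟨⟨s.edges, x', s.bought, s.cost⟩, ⟨h.edges_subset,
    fun e => (h.frac_nonneg e).trans (hxx' e), hx4, fun F hF hfF => ?_, h.conn, h.edges_cost,
    h.separated, fun p hp ρ' h0 h1 => ?_⟩, subset_rfl, rfl, ?_⟩
  · have h1 := h.frac_cost F hF hfF
    have h2 := hpot F hF (hcover F (hfeas F hfF))
    have h3 : b / (Fintype.card V : ℝ) = 4 * (b / (4 * (Fintype.card V : ℝ))) := by
      field_simp
    dsimp only
    linarith
  · refine (h.dense p hp ρ' h0 h1).trans ?_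
    dsimp only
    gcongr with e he
    · exact edgeDiff_nonneg _ e
    · exact hxx' e
  · refine le_trans ?_ (hpot E subset_rfl (hcover E hfE))
    gcongr

/-- The algorithm can serve a group request while preserving its invariants. -/
theorem GreedyState.Invariant.exists_serve {V : Type*} [Fintype V] {E : Finset (Sym2 V)}
    {w : Sym2 V → ℝ} {r : V} {ε δ R : ℝ} {Feas : Finset (Sym2 V) → Prop} {s : GreedyState V}
    (h : s.Invariant E w r ε δ R Feas) (hw : ∀ e ∈ E, 1 ≤ w e)
    (hE : ∀ u v : V, EdgeConn (↑E) u v) (hδ : 0 < δ) (hδ1 : δ ≤ 1)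
    (hδE : δ * (E.card * Fintype.card V) ≤ 1 / 2) {g : Set V} {f : ℕ} (hf : 1 ≤ f)
    (hfg : f ≤ g.ncard) (hR : (g.ncard : ℝ) ≤ R * f) (hR0 : 0 < R) (hε : 0 < ε)
    (hfeas : ∀ F, Feas F → f ≤ connVerts r F g) :
    ∃ s' : GreedyState V, s'.Invariant E w r ε δ R Feas ∧ s.edges ⊆ s'.edges ∧
      (1 - ε) * f ≤ connVerts r s'.edges g := by
  have hw0 : ∀ e ∈ E, 0 ≤ w e := fun e he => zero_le_one.trans (hw e he)
  have hn : (0 : ℝ) < Fintype.card V := by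
    have : Nonempty V := ⟨r⟩
    exact_mod_cast Fintype.card_pos
  set n : ℝ := (Fintype.card V : ℝ) with hn_def
  set m : GreedyState V → ℝ := fun s =>
    s.bought.card + 4 * n * ∑ e ∈ E, w e * Real.log ((s.frac e + δ) / δ) with hm
  have hstep : ∀ s : GreedyState V, s.Invariant E w r ε δ R Feas →
      (connVerts r s.edges g : ℝ) < (1 - ε) * f →
      ∃ s' : GreedyState V, s'.Invariant E w r ε δ R Feas ∧ s.edges ⊆ s'.edges ∧
        m s + 1 ≤ m s' := by
    intro s h hunsat
    choose F hFE hF hmin using fun v => exists_cheapest_attachment w hE s.edges r v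
    by_cases hv : ∃ v ∈ g, ¬EdgeConn (↑s.edges) v r ∧ ∀ ρ : ℝ, 0 < ρ →
        2 * ρ ≤ ∑ e ∈ F v, w e →
          ε * ρ ≤ 2 * R * ∑ e ∈ E, s.frac e * edgeDiff (bump E w ρ v) e
    · obtain ⟨v, -, hv, hdense⟩ := hv
      obtain ⟨s', h1, h2, h3, h4⟩ := h.exists_attach hw0 hv (hFE v) (hF v) (hmin v) hdense
      refine ⟨s', h1, h2, le_of_eq ?_⟩
      simp only [hm, h3, h4]
      push_cast
      ring
    · push Not at hv
      choose! ρ hρ using hv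
      obtain ⟨s', h1, h2, h3, h4⟩ := h.exists_increase hw hE hδ hδ1 hδE hf hfg hR hR0 hε hfeas
        hunsat (d := fun v => ∑ e ∈ F v, w e) (fun v => hmin v r (EdgeConn.refl _ r)) hρ
      refine ⟨s', h1, h2, ?_⟩
      simp only [hm, h3]
      rw [← hn_def, div_le_iff₀ (by positivity)] at h4
      linarith
  have hbound : ∀ s : GreedyState V, s.Invariant E w r ε δ R Feas →
      m s ≤ n + 4 * n * ∑ e ∈ E, w e * Real.log (4 / δ) := by
    intro s h
    have h1 : (s.bought.card : ℝ) ≤ n := by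
      rw [hn_def]
      exact_mod_cast s.bought.card_le_univ
    refine add_le_add h1 ?_
    gcongr with e he
    · exact hw0 e he
    · have := h.frac_nonneg e
      positivity
    · exact h.frac_le e
  set B : ℝ := n + 4 * n * ∑ e ∈ E, w e * Real.log (4 / δ) with hB
  have key : ∀ (k : ℕ) (s : GreedyState V), s.Invariant E w r ε δ R Feas → B - k ≤ m s →
      ∃ s' : GreedyState V, s'.Invariant E w r ε δ R Feas ∧ s.edges ⊆ s'.edges ∧
        (1 - ε) * f ≤ connVerts r s'.edges g := by
    intro k
    induction k with
    | zero =>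
      intro s h hk
      refine ⟨s, h, subset_rfl, ?_⟩
      by_contra hcon
      obtain ⟨s', h1, -, h2⟩ := hstep s h (not_le.1 hcon)
      have := hbound s' h1
      push_cast at hk
      linarith
    | succ k ih =>
      intro s h hk
      rcases le_or_gt ((1 - ε) * f) (connVerts r s.edges g : ℝ) with hsat | hunsat
      · exact ⟨s, h, subset_rfl, hsat⟩
      · obtain ⟨s', h1, h2, h3⟩ := hstep s h hunsat
        push_cast at hk
        obtain ⟨s'', h4, h5, h6⟩ := ih s' h1 (by linarith)
        exact ⟨s'', h4, h2.trans h5, h6⟩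
  obtain ⟨k, hk⟩ := exists_nat_ge (B - m s)
  exact key k s h (by linarith)

/-- The edges bought by the algorithm cost at most a harmonic factor times the cost of the
fractional solution. -/
theorem GreedyState.Invariant.sum_edges_le {V : Type*} {E : Finset (Sym2 V)}
    {w : Sym2 V → ℝ} {r : V} {ε δ R : ℝ} {Feas : Finset (Sym2 V) → Prop} {s : GreedyState V}
    (h : s.Invariant E w r ε δ R Feas) (hw : ∀ e ∈ E, 0 ≤ w e)
    (hE : ∀ u v : V, EdgeConn (↑E) u v) (hR : 0 ≤ R) (hε : 0 < ε) :
    ∑ e ∈ s.edges, w e ≤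
      8 * R * (∑ e ∈ E, w e * s.frac e) / ε * harmonic s.bought.card := by
  have hX : 0 ≤ ∑ e ∈ E, w e * s.frac e :=
    Finset.sum_nonneg fun e he => mul_nonneg (hw e he) (h.frac_nonneg e)
  refine h.edges_cost.trans (sum_le_mul_harmonic s.bought s.cost (by positivity) ?_)
  intro Q hQ d hd hQd
  have h1 : ∀ p ∈ Q, ε * (d / 2) ≤
      2 * R * ∑ e ∈ E, s.frac e * edgeDiff (bump E w (d / 2) p) e := fun p hp =>
    h.dense p (hQ hp) (d / 2) (by positivity) (by linarith [hQd p hp])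
  have h2 := Finset.card_nsmul_le_sum Q _ _ h1
  rw [← Finset.mul_sum, Finset.sum_comm, nsmul_eq_mul] at h2
  have h3 : ∑ e ∈ E, ∑ p ∈ Q, s.frac e * edgeDiff (bump E w (d / 2) p) e ≤
      2 * ∑ e ∈ E, w e * s.frac e := by
    rw [Finset.mul_sum]
    refine Finset.sum_le_sum fun e he => ?_
    rw [← Finset.mul_sum]
    have h4 := sum_edgeDiff_bump_le hw hE (d / 2) Q (fun p hp q hq hpq => by
      have := h.separated p (hQ hp) q (hQ hq) hpq
      have := le_min (hQd p hp) (hQd q hq)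
      linarith) he
    have h5 := mul_le_mul_of_nonneg_left h4 (h.frac_nonneg e)
    linarith
  have h4 := mul_le_mul_of_nonneg_left h3 (by positivity : 0 ≤ 2 * R)
  rw [le_div_iff₀ hε]
  linarith

theorem GreedyState.Invariant.sum_edges_le_log {V : Type*} [Fintype V] {E : Finset (Sym2 V)}
    {w : Sym2 V → ℝ} {r : V} {ε R : ℝ} {Feas : Finset (Sym2 V) → Prop} {s : GreedyState V}
    (h : s.Invariant E w r ε (1 / (Fintype.card V : ℝ) ^ 4) R Feas) (hw : ∀ e ∈ E, 0 ≤ w e)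
    (hE : ∀ u v : V, EdgeConn (↑E) u v) (hR : 0 ≤ R) (hε : 0 < ε) (hn : 2 ≤ Fintype.card V)
    {F : Finset (Sym2 V)} (hFE : F ⊆ E) (hF : Feas F) :
    ∑ e ∈ s.edges, w e ≤
      1152 * (Real.log (Fintype.card V : ℝ) ^ 3 / ε) * R * ∑ e ∈ F, w e := by
  have hn2 : (2 : ℝ) ≤ Fintype.card V := by exact_mod_cast hn
  have hharm : (harmonic s.bought.card : ℝ) ≤ 1 + Real.log (Fintype.card V : ℝ) := by
    have h1 : harmonic s.bought.card ≤ harmonic (Fintype.card V) := by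
      unfold harmonic
      exact Finset.sum_le_sum_of_subset_of_nonneg
        (Finset.range_subset_range.2 s.bought.card_le_univ) fun i _ _ => by positivity
    exact le_trans (by exact_mod_cast h1) (harmonic_le_one_add_log _)
  set n : ℝ := (Fintype.card V : ℝ) with hn_def
  have hlog : 1 / 2 ≤ Real.log n := by
    have := Real.log_two_gt_d9
    have := Real.log_le_log (by norm_num) hn2
    linarith
  have hW : 0 ≤ ∑ e ∈ F, w e := Finset.sum_nonneg fun e he => hw e (hFE he)
  have hX : ∑ e ∈ E, w e * s.frac e ≤ 24 * Real.log n * ∑ e ∈ F, w e := by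
    have h1 : ∀ e ∈ F, w e * Real.log ((s.frac e + 1 / n ^ 4) / (1 / n ^ 4)) ≤
        w e * (6 * Real.log n) := fun e he => by
      refine mul_le_mul_of_nonneg_left ?_ (hw e (hFE he))
      have h2 : 6 * Real.log n = Real.log (n ^ 6) := by
        rw [Real.log_pow]; norm_num
      have h0 := h.frac_nonneg e
      rw [h2]
      refine Real.log_le_log (by positivity) ?_
      rw [div_div_eq_mul_div, div_one]
      have h3 := mul_le_mul_of_nonneg_right (h.frac_le e) (by positivity : 0 ≤ n ^ 4)
      refine h3.trans ?_
      rw [show n ^ 6 = n ^ 2 * n ^ 4 by ring]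
      gcongr
      nlinarith
    have h2 := Finset.sum_le_sum h1
    rw [← Finset.sum_mul] at h2
    have h3 := h.frac_cost F hFE hF
    linarith
  refine (h.sum_edges_le hw hE hR hε).trans ?_
  have h3 : (harmonic s.bought.card : ℝ) ≤ 3 * Real.log n := by linarith
  have h4 : 8 * R * (∑ e ∈ E, w e * s.frac e) / ε ≤
      8 * R * (24 * Real.log n * ∑ e ∈ F, w e) / ε := by gcongr
  have h5 : 0 ≤ 8 * R * (24 * Real.log n * ∑ e ∈ F, w e) / ε := by positivity
  have h6 : (0 : ℝ) ≤ harmonic s.bought.card := by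
    unfold harmonic
    push_cast
    exact Finset.sum_nonneg fun i _ => by positivity
  refine (mul_le_mul h4 h3 h6 h5).trans ?_
  have h7 : 0 ≤ R * (∑ e ∈ F, w e) / ε * Real.log n ^ 2 := by positivity
  calc 8 * R * (24 * Real.log n * ∑ e ∈ F, w e) / ε * (3 * Real.log n)
      = 576 * (R * (∑ e ∈ F, w e) / ε * Real.log n ^ 2) := by ring
    _ ≤ 1152 * (R * (∑ e ∈ F, w e) / ε * Real.log n ^ 2) * Real.log n := by nlinarith
    _ = _ := by ring

/-- Building a map on lists step by step from an invariant that can be maintained online. -/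
theorem exists_online_map {α β : Type*} {P : List α → β → Prop} {Q : β → β → Prop}
    {valid : List α → Prop} (hvalid : ∀ l q, valid (l ++ [q]) → valid l) {b₀ : β}
    (h₀ : P [] b₀)
    (hstep : ∀ l q b, valid (l ++ [q]) → P l b → ∃ b', P (l ++ [q]) b' ∧ Q b b') :
    ∃ S : List α → β, (∀ l, valid l → P l (S l)) ∧
      ∀ l q, valid (l ++ [q]) → Q (S l) (S (l ++ [q])) := by
  classical
  have hstep' : ∀ l q b, ∃ b', valid (l ++ [q]) → P l b → P (l ++ [q]) b' ∧ Q b b' := by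
    intro l q b
    by_cases h : valid (l ++ [q]) ∧ P l b
    · obtain ⟨b', hb'⟩ := hstep l q b h.1 h.2
      exact ⟨b', fun _ _ => hb'⟩
    · exact ⟨b, fun h1 h2 => absurd ⟨h1, h2⟩ h⟩
  choose next hnext using hstep'
  let S : List α → β := fun l => List.reverseRecOn l b₀ fun l q b => next l q b
  have hS : ∀ l q, S (l ++ [q]) = next l q (S l) := fun l q => List.reverseRecOn_concat ..
  have hP : ∀ l, valid l → P l (S l) := by
    intro l
    induction l using List.reverseRecOn with
    | nil => exact fun _ => by simpa [S] using h₀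
    | append_singleton l q ih =>
      intro hv
      rw [hS]
      exact (hnext l q (S l) hv (ih (hvalid l q hv))).1
  refine ⟨S, hP, fun l q hv => ?_⟩
  rw [hS]
  exact (hnext l q (S l) hv (hP l (hvalid l q hv))).2

theorem foldr_max_concat (L : List ℝ) (a : ℝ) :
    (L ++ [a]).foldr max 0 = max (L.foldr max 0) a := by
  induction L with
  | nil => simp [max_comm]
  | cons b L ih => simp only [List.cons_append, List.foldr_cons, ih, max_assoc]

theorem foldr_max_nonneg (L : List ℝ) : 0 ≤ L.foldr max 0 := by
  induction L with
  | nil => simp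
  | cons b L ih => exact ih.trans (le_max_right _ _)

/-- There is a universal constant `C` such that on every weighted graph
`G` on `n ≥ 2` vertices with root `r`, for every `ε ∈ (0,1)`, there is an online algorithm
for online `f`-partial group Steiner tree that is `(1−ε)`-connection-competitive and whose
cost on every request sequence is at most `C·(log³n/ε)·(max_{i≤t} |gᵢ|/fᵢ)·OPT_t`. -/
theorem onlinePartialGST_general_graphs :
    ∃ C : ℝ, 0 < C ∧
      ∀ (V : Type) [Fintype V], ∀ (G : SimpleGraph V) (w : Sym2 V → ℝ) (r : V),
        2 ≤ Fintype.card V → G.Connected → (∀ e ∈ G.edgeSet, 1 ≤ w e) →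
        ∀ ε : ℝ, 0 < ε → ε < 1 →
        ∃ A : List (Set V × ℕ) → Finset (Sym2 V),
          -- solutions are edge sets of `G`
          (∀ l : List (Set V × ℕ), ValidFP l → ↑(A l) ⊆ G.edgeSet) ∧
          -- the solution only grows under one-step extensions
          (∀ (l : List (Set V × ℕ)) (q : Set V × ℕ),
            ValidFP (l ++ [q]) → A l ⊆ A (l ++ [q])) ∧
          -- `(1−ε)`-connection-competitive
          (∀ l : List (Set V × ℕ), ValidFP l → ∀ q ∈ l,
            (1 - ε) * (q.2 : ℝ) ≤ (connVerts r (A l) q.1 : ℝ)) ∧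
          -- cost-competitiveness against every offline feasible solution
          (∀ l : List (Set V × ℕ), ValidFP l →
            ∀ F : Finset (Sym2 V), ↑F ⊆ G.edgeSet →
              (∀ q ∈ l, q.2 ≤ connVerts r F q.1) →
              ∑ e ∈ A l, w e ≤
                C * (Real.log (Fintype.card V : ℝ) ^ 3 / ε) *
                  ((l.map fun q => (q.1.ncard : ℝ) / (q.2 : ℝ)).foldr max 0) *
                  ∑ e ∈ F, w e) := by
  refine ⟨1152, by norm_num, fun V _ G w r hn hG hw ε hε hε1 => ?_⟩
  classical
  set E : Finset (Sym2 V) := G.edgeFinset with hE_def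
  have hEcoe : (E : Set (Sym2 V)) = G.edgeSet := G.coe_edgeFinset
  have hE : ∀ u v : V, EdgeConn (↑E) u v := fun u v => by
    rw [hEcoe, EdgeConn, SimpleGraph.fromEdgeSet_edgeSet]
    exact hG.preconnected u v
  have hwE : ∀ e ∈ E, 1 ≤ w e := fun e he => hw e (by rwa [← hEcoe])
  have hn2 : (2 : ℝ) ≤ Fintype.card V := by exact_mod_cast hn
  set n : ℝ := (Fintype.card V : ℝ) with hn_def
  have hEn : (E.card : ℝ) ≤ n ^ 2 := by
    have h1 : E.card ≤ Fintype.card (V × V) :=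
      E.card_le_univ.trans (Fintype.card_le_of_surjective _ Sym2.mk_surjective)
    rw [Fintype.card_prod] at h1
    rw [pow_two, hn_def]
    exact_mod_cast h1
  have hδ1 : 1 / n ^ 4 ≤ 1 := by
    rw [div_le_one (by positivity)]
    exact one_le_pow₀ (by linarith)
  have hδE : 1 / n ^ 4 * (E.card * n) ≤ 1 / 2 := by
    rw [div_mul_eq_mul_div, div_le_div_iff₀ (by positivity) (by norm_num)]
    have h1 : (E.card : ℝ) * n ≤ n ^ 2 * n := by gcongr
    have h2 : n ^ 2 * n * 2 ≤ n ^ 2 * n * n := by gcongr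
    nlinarith
  set R : List (Set V × ℕ) → ℝ := fun l =>
    (l.map fun q => (q.1.ncard : ℝ) / (q.2 : ℝ)).foldr max 0 with hR
  have hR0 : ∀ l, 0 ≤ R l := fun l => foldr_max_nonneg _
  have hRc : ∀ l q, R (l ++ [q]) = max (R l) ((q.1.ncard : ℝ) / (q.2 : ℝ)) := fun l q => by
    simp only [hR, List.map_append, List.map_cons, List.map_nil, foldr_max_concat]
  set Feas : List (Set V × ℕ) → Finset (Sym2 V) → Prop := fun l F =>
    ∀ q ∈ l, q.2 ≤ connVerts r F q.1 with hFeas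
  obtain ⟨S, hS, hSmono⟩ := exists_online_map
    (P := fun l (s : GreedyState V) => s.Invariant E w r ε (1 / n ^ 4) (R l) (Feas l) ∧
      ∀ q ∈ l, (1 - ε) * (q.2 : ℝ) ≤ (connVerts r s.edges q.1 : ℝ))
    (Q := fun s s' : GreedyState V => s.edges ⊆ s'.edges) (valid := ValidFP)
    (fun l q h p hp => h p (List.mem_append_left _ hp))
    (b₀ := ⟨∅, fun _ => 0, ∅, fun _ => 0⟩)
    ⟨⟨by simp, by simp, fun e => by simp only [zero_add]; linarith,
      fun F _ _ => by simp [show n ≠ 0 by positivity], by simp, by simp, by simp, by simp⟩, by simp⟩ (by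
      rintro l q s hv ⟨hs, hsat⟩
      obtain ⟨hq1, hq2⟩ := hv q (by simp)
      have hq0 : (0 : ℝ) < q.2 := by exact_mod_cast hq1
      have hg0 : (0 : ℝ) < q.1.ncard := by exact_mod_cast hq1.trans hq2
      have hle : (q.1.ncard : ℝ) / q.2 ≤ R (l ++ [q]) := (hRc l q).symm ▸ le_max_right _ _
      obtain ⟨s', h1, h2, h3⟩ := (hs.mono (R' := R (l ++ [q])) (Feas' := Feas (l ++ [q]))
        ((hRc l q).symm ▸ le_max_left _ _)
        fun F hF p hp => hF p (List.mem_append_left _ hp)).exists_serve hwE hE (by positivity)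
          hδ1 hδE hq1 hq2 ((div_le_iff₀ hq0).1 hle) ((div_pos hg0 hq0).trans_le hle) hε
          fun F hF => hF q (by simp)
      refine ⟨s', ⟨h1, fun p hp => ?_⟩, h2⟩
      rcases List.mem_append.1 hp with hp | hp
      · exact (hsat p hp).trans (by exact_mod_cast connVerts_mono r h2 p.1)
      · rw [List.mem_singleton.1 hp]
        exact h3)
  refine ⟨fun l => (S l).edges, fun l hl => ?_, hSmono, fun l hl => (hS l hl).2,
    fun l hl F hF hfeas => ?_⟩
  · rw [← hEcoe]
    exact Finset.coe_subset.2 (hS l hl).1.edges_subset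
  · exact (hS l hl).1.sum_edges_le_log (fun e he => zero_le_one.trans (hwE e he)) hE (hR0 l) hε hn
      (by rw [← hEcoe] at hF; exact Finset.coe_subset.1 hF) hfeas
end

section
/- There is a universal constant C such that: given a hierarchical decomposition H of a finite metric (V,d) with all distances at least 1 and a root r ∈ V that is α-padded in H, there exists a (C/α)-partial tree embedding T=(V',E') of (V,d) rooted at r whose vertex set is V' = {v ∈ V : v is α-padded in H}. -/
/-- A rooted weighted tree is well-separated if every child edge has weight at most half
the weight of its parent edge. -/
def WellSeparated {V : Type*} (T : SimpleGraph V) (root : V) (w : Sym2 V → ℝ) : Prop :=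
  ∀ a b c : V, T.Adj a b → T.Adj b c →
    T.dist root b = T.dist root a + 1 → T.dist root c = T.dist root b + 1 →
    w s(b, c) ≤ w s(a, b) / 2

/-- The weighted (shortest-path) distance between `u` and `v` in the weighted graph
`(T, w)`: the infimum of the total weights of walks from `u` to `v`. -/
noncomputable def wDist {α : Type*} (T : SimpleGraph α) (w : Sym2 α → ℝ) (u v : α) : ℝ :=
  sInf {x : ℝ | ∃ p : T.Walk u v, x = (p.edges.map w).sum}

/-- A `γ`-partial tree embedding of the metric `(V, d)`: a well-separated weighted rooted
tree on a subset `verts ⊆ V` whose tree metric satisfies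
`d(u,v) ≤ d_T(u,v) ≤ γ·d(u,v)` for all embedded `u, v`. -/
structure PartialTreeEmbedding (V : Type*) (d : V → V → ℝ) (γ : ℝ) where
  verts : Set V
  tree : SimpleGraph verts
  isTree : tree.IsTree
  w' : Sym2 verts → ℝ
  root : verts
  wellSep : WellSeparated tree root w'
  dist_le_treeDist : ∀ u v : verts, d ↑u ↑v ≤ wDist tree w' u v
  treeDist_le : ∀ u v : verts, wDist tree w' u v ≤ γ * d ↑u ↑v

/-- A hierarchical decomposition of the metric `(V, d)`. -/
structure HierDecomp (V : Type*) (d : V → V → ℝ) where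
  h : ℕ
  P : ℕ → Set (Set V)
  partition : ∀ i ≤ h, Setoid.IsPartition (P i)
  top : P h = {Set.univ}
  part_diam : ∀ i ≤ h, ∀ p ∈ P i, ∀ u ∈ p, ∀ v ∈ p, d u v ≤ 2 ^ i
  refines : ∀ i < h, ∀ p ∈ P i, ∃ q ∈ P (i + 1), p ⊆ q
  metric_diam : ∀ u v : V, d u v ≤ 2 ^ h

/-- A node `v` is `α`-padded in the hierarchical decomposition `H` if for every level `i`
the ball `B(v, α·2^i)` is contained in a single part of `P i`. -/
def HierDecomp.Padded {V : Type*} {d : V → V → ℝ} (H : HierDecomp V d) (α : ℝ)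
    (v : V) : Prop :=
  ∀ i ≤ H.h, ∃ p ∈ H.P i, {u : V | d v u ≤ α * 2 ^ i} ⊆ p

section ParentGraph

variable {W : Type*} {r : W} {p : W → W} {k : W → ℕ} {N : ℕ}

/-- The graph joining every element to its image under the parent map `p`. -/
def parentGraph (p : W → W) : SimpleGraph W := SimpleGraph.fromRel fun a b => p a = b

theorem parentGraph_adj {a b : W} :
    (parentGraph p).Adj a b ↔ a ≠ b ∧ (p a = b ∨ p b = a) := SimpleGraph.fromRel_adj _ _ _

theorem parentGraph_adj_parent (hk : ∀ v, v ≠ r → k v < k (p v)) {v : W} (hv : v ≠ r) :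
    (parentGraph p).Adj v (p v) :=
  parentGraph_adj.2 ⟨fun h => (hk v hv).ne (congrArg k h), Or.inl rfl⟩

theorem exists_iterate_parent_eq_root (hN : ∀ v, k v ≤ N) (hk : ∀ v, v ≠ r → k v < k (p v))
    (v : W) : ∃ m, p^[m] v = r := by
  induction h : N - k v using Nat.strong_induction_on generalizing v with
  | _ n ih =>
    by_cases hv : v = r
    · exact ⟨0, hv⟩
    · have h1 := hk v hv
      have h2 := hN (p v)
      obtain ⟨m, hm⟩ := ih (N - k (p v)) (by omega) (p v) rfl
      exact ⟨m + 1, hm⟩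

theorem parentGraph_isTree [Finite W] (hN : ∀ v, k v ≤ N) (hk : ∀ v, v ≠ r → k v < k (p v))
    (hr : p r = r) : (parentGraph p).IsTree := by
  have reach : ∀ m v, p^[m] v = r → (parentGraph p).Reachable v r := by
    intro m
    induction m with
    | zero => rintro v rfl; rfl
    | succ m ih =>
      intro v hv
      by_cases h : v = r
      · rw [h]
      · exact (parentGraph_adj_parent hk h).reachable.trans (ih (p v) hv)
  have reach' : ∀ v, (parentGraph p).Reachable v r := fun v =>
    (exists_iterate_parent_eq_root hN hk v).elim fun m hm => reach m v hm
  rw [SimpleGraph.isTree_iff_connected_and_card]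
  have : Nonempty W := ⟨r⟩
  refine ⟨⟨fun u v => (reach' u).trans (reach' v).symm⟩, ?_⟩
  have e : {v : W // v ≠ r} ≃ (parentGraph p).edgeSet := by
    refine Equiv.ofBijective
      (fun v => ⟨s(v.1, p v.1), parentGraph_adj_parent hk v.2⟩) ⟨?_, ?_⟩
    · rintro ⟨u, hu⟩ ⟨v, hv⟩ h
      have h' : s(u, p u) = s(v, p v) := congrArg Subtype.val h
      rcases Sym2.eq_iff.1 h' with ⟨h1, -⟩ | ⟨h1, h2⟩
      · exact Subtype.ext h1
      · have h3 := hk u hu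
        have h4 := hk v hv
        rw [h2] at h3
        rw [← h1] at h4
        omega
    · rintro ⟨e, he⟩
      induction e with
      | _ a b =>
        obtain ⟨hne, h | h⟩ := parentGraph_adj.1 he
        · have ha : a ≠ r := by
            rintro rfl
            exact hne (hr.symm.trans h)
          exact ⟨⟨a, ha⟩, Subtype.ext (by simp [h])⟩
        · have hb : b ≠ r := by
            rintro rfl
            exact hne (h.symm.trans hr)
          exact ⟨⟨b, hb⟩, Subtype.ext (by simp [h, Sym2.eq_swap])⟩
  rw [← Nat.card_congr e]
  have h1 := Set.ncard_add_ncard_compl ({r} : Set W)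
  rw [Set.ncard_singleton] at h1
  rw [← h1, add_comm]
  rfl

theorem parentGraph_dist_root [Finite W] (hN : ∀ v, k v ≤ N)
    (hk : ∀ v, v ≠ r → k v < k (p v)) (hr : p r = r) {v : W} (hv : v ≠ r) :
    (parentGraph p).dist r v = (parentGraph p).dist r (p v) + 1 := by
  classical
  have ex := exists_iterate_parent_eq_root hN hk
  have conn := (parentGraph_isTree hN hk hr).connected
  let n : W → ℕ := fun v => Nat.find (ex v)
  have n_root : n r = 0 := (Nat.find_eq_zero (ex r)).2 rfl
  have n_succ : ∀ v, v ≠ r → n v = n (p v) + 1 := fun v hv =>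
    Nat.find_comp_succ (ex v) (ex (p v)) hv
  have n_le : ∀ {u v : W} (q : (parentGraph p).Walk u v), n v ≤ n u + q.length := by
    intro u v q
    induction q with
    | nil => simp
    | @cons a b c hab q ih =>
      have : n b ≤ n a + 1 := by
        obtain ⟨hne, h | h⟩ := parentGraph_adj.1 hab
        · have ha : a ≠ r := by
            rintro rfl
            exact hne (hr.symm.trans h)
          have := n_succ a ha
          rw [h] at this
          omega
        · have hb : b ≠ r := by
            rintro rfl
            exact hne (h.symm.trans hr)
          have := n_succ b hb
          rw [h] at this
          omega
      rw [SimpleGraph.Walk.length_cons]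
      omega
  have le_n : ∀ m v, n v = m → (parentGraph p).dist r v ≤ m := by
    intro m
    induction m with
    | zero =>
      intro v h
      rw [show v = r from (Nat.find_eq_zero (ex v)).1 h]
      simp
    | succ m ih =>
      intro v h
      have hv : v ≠ r := by
        rintro rfl
        omega
      have h1 := ih (p v) (by have := n_succ v hv; omega)
      have h2 := conn.dist_triangle (u := r) (v := p v) (w := v)
      have h3 := SimpleGraph.dist_eq_one_iff_adj.2 (parentGraph_adj_parent hk hv).symm
      omega
  have key : ∀ v, (parentGraph p).dist r v = n v := by
    intro v
    obtain ⟨q, hq⟩ := conn.exists_walk_length_eq_dist r v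
    have := n_le q
    have := le_n _ v rfl
    omega
  rw [key, key, n_succ v hv]

/-- The weight `2 ^ min (k a) (k b)` of the pair `{a, b}`; on the edge joining `v` to its
parent it equals `2 ^ k v`. -/
noncomputable def levelWeight (k : W → ℕ) : Sym2 W → ℝ :=
  Sym2.lift ⟨fun a b => 2 ^ min (k a) (k b), fun a b => by simp only [min_comm]⟩

theorem levelWeight_mk (a b : W) : levelWeight k s(a, b) = 2 ^ min (k a) (k b) := rfl

theorem levelWeight_nonneg (e : Sym2 W) : 0 ≤ levelWeight k e := by
  induction e with
  | _ a b => rw [levelWeight_mk]; positivity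

theorem wellSeparated_parentGraph [Finite W] (hN : ∀ v, k v ≤ N)
    (hk : ∀ v, v ≠ r → k v < k (p v)) (hr : p r = r) :
    WellSeparated (parentGraph p) r (levelWeight k) := by
  have parent : ∀ a b, (parentGraph p).Adj a b →
      (parentGraph p).dist r b = (parentGraph p).dist r a + 1 → k a < k b → False := by
    intro a b hab hd hlt
    obtain ⟨hne, h | h⟩ := parentGraph_adj.1 hab
    · have ha : a ≠ r := by
        rintro rfl
        exact hne (hr.symm.trans h)
      have := parentGraph_dist_root hN hk hr ha
      rw [h] at this
      omega
    · have hb : b ≠ r := by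
        rintro rfl
        exact hne (h.symm.trans hr)
      have := hk b hb
      rw [h] at this
      omega
  have adj_ne : ∀ a b, (parentGraph p).Adj a b → k a ≠ k b := by
    intro a b hab
    obtain ⟨hne, h | h⟩ := parentGraph_adj.1 hab
    · have ha : a ≠ r := by
        rintro rfl
        exact hne (hr.symm.trans h)
      exact h ▸ (hk a ha).ne
    · have hb : b ≠ r := by
        rintro rfl
        exact hne (h.symm.trans hr)
      exact h ▸ (hk b hb).ne'
  intro a b c hab hbc h1 h2
  have hba : k b < k a :=
    lt_of_le_of_ne (not_lt.1 (parent a b hab h1)) (adj_ne a b hab).symm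
  have hcb : k c < k b :=
    lt_of_le_of_ne (not_lt.1 (parent b c hbc h2)) (adj_ne b c hbc).symm
  rw [levelWeight_mk, levelWeight_mk, min_eq_right hcb.le, min_eq_right hba.le,
    le_div_iff₀ two_pos, ← pow_succ]
  exact pow_le_pow_right₀ one_le_two hcb

end ParentGraph

section WeightedDistance

variable {W : Type*} {T : SimpleGraph W} {w : Sym2 W → ℝ}

theorem wDist_le_of_walk (hw : ∀ e, 0 ≤ w e) {u v : W} (q : T.Walk u v) :
    wDist T w u v ≤ (q.edges.map w).sum := by
  refine csInf_le ⟨0, ?_⟩ ⟨q, rfl⟩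
  rintro x ⟨q, rfl⟩
  exact List.sum_nonneg fun x hx => by
    obtain ⟨e, -, rfl⟩ := List.mem_map.1 hx
    exact hw e

theorem le_wDist (hT : T.Connected) {d : W → W → ℝ} (h0 : ∀ u, d u u = 0)
    (tri : ∀ u v x, d u x ≤ d u v + d v x) (hd : ∀ a b, T.Adj a b → d a b ≤ w s(a, b))
    (u v : W) : d u v ≤ wDist T w u v := by
  refine le_csInf ((hT.preconnected u v).elim fun q => ⟨_, q, rfl⟩) ?_
  rintro x ⟨q, rfl⟩
  induction q with
  | nil => simp [h0]
  | @cons a b c hab q ih =>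
    rw [SimpleGraph.Walk.edges_cons, List.map_cons, List.sum_cons]
    linarith [tri a b c, hd a b hab]

end WeightedDistance

/-- A system of nested leaders: `ℓ j v` is the leader of the level-`j` cluster of `v`,
every leader of a cluster is the leader of its own subclusters, level `0` clusters are
singletons, and from level `N` on there is a single cluster, led by `r`. -/
structure LeaderSystem {W : Type*} (ℓ : ℕ → W → W) (r : W) (N : ℕ) : Prop where
  zero : ∀ v, ℓ 0 v = v
  top : ∀ j, N ≤ j → ∀ v, ℓ j v = r
  idem : ∀ j v, ℓ j (ℓ j v) = ℓ j v
  nested : ∀ j v, ℓ (j + 1) (ℓ j v) = ℓ (j + 1) v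
  inherit : ∀ j v, ℓ (j + 1) v = v → ℓ j v = v

namespace LeaderSystem

variable {W : Type*} {ℓ : ℕ → W → W} {r : W} {N : ℕ}

open Classical in
/-- The highest level at which `v` leads its cluster. -/
noncomputable def level (ℓ : ℕ → W → W) (N : ℕ) (v : W) : ℕ :=
  Nat.findGreatest (fun j => ℓ j v = v) N

/-- The leader of the lowest cluster that contains `v` and is not led by `v`. -/
noncomputable def parent (ℓ : ℕ → W → W) (N : ℕ) (v : W) : W := ℓ (level ℓ N v + 1) v

theorem level_le (v : W) : level ℓ N v ≤ N := by
  classical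
  exact Nat.findGreatest_le N

open Classical in
theorem le_level {j : ℕ} {v : W} (hj : j ≤ N) (h : ℓ j v = v) : j ≤ level ℓ N v :=
  Nat.le_findGreatest hj h

open Classical in
theorem apply_level (L : LeaderSystem ℓ r N) (v : W) : ℓ (level ℓ N v) v = v :=
  Nat.findGreatest_spec (P := fun j => ℓ j v = v) (Nat.zero_le N) (L.zero v)

theorem apply_of_le (L : LeaderSystem ℓ r N) {i j : ℕ} (hij : i ≤ j) {v : W}
    (h : ℓ j v = v) : ℓ i v = v := by
  induction j, hij using Nat.le_induction with
  | base => exact h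
  | succ j _ ih => exact ih (L.inherit j v h)

theorem level_lt (L : LeaderSystem ℓ r N) {v : W} (hv : v ≠ r) : level ℓ N v < N := by
  refine lt_of_le_of_ne (level_le v) fun h => hv ?_
  rw [← L.apply_level v, h, L.top N le_rfl]

theorem level_lt_level_parent (L : LeaderSystem ℓ r N) (v : W) (hv : v ≠ r) :
    level ℓ N v < level ℓ N (parent ℓ N v) :=
  le_level (L.level_lt hv) (L.idem _ v)

theorem parent_root (L : LeaderSystem ℓ r N) : parent ℓ N r = r := by
  have : level ℓ N r = N := le_antisymm (level_le r) (le_level le_rfl (L.top N le_rfl r))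
  rw [parent, this, L.top _ (Nat.le_succ N)]

theorem exists_walk_leader (L : LeaderSystem ℓ r N) (j : ℕ) (v : W) :
    ∃ q : (parentGraph (parent ℓ N)).Walk v (ℓ j v),
      (q.edges.map (levelWeight (level ℓ N))).sum ≤ 2 ^ j := by
  suffices ∃ q : (parentGraph (parent ℓ N)).Walk v (ℓ j v),
      (q.edges.map (levelWeight (level ℓ N))).sum ≤ 2 ^ j - 1 by
    obtain ⟨q, hq⟩ := this
    exact ⟨q, by linarith⟩
  induction j with
  | zero => exact ⟨SimpleGraph.Walk.nil.copy rfl (L.zero v).symm, by simp⟩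
  | succ j ih =>
    obtain ⟨q, hq⟩ := ih
    have hpow : (2 : ℝ) ^ (j + 1) = 2 ^ j + 2 ^ j := by ring
    have hnest := L.nested j v
    have hx := L.idem j v
    have htop := L.top j
    generalize ℓ j v = x at *
    by_cases h : ℓ (j + 1) x = x
    · refine ⟨q.copy rfl (h.symm.trans hnest), ?_⟩
      have : (0 : ℝ) ≤ 2 ^ j := by positivity
      rw [SimpleGraph.Walk.edges_copy]
      linarith
    · have hjN : j < N := by
        by_contra! hj
        exact h ((L.top (j + 1) (hj.trans j.le_succ) x).trans ((htop hj x).symm.trans hx))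
      have hlev : level ℓ N x = j := by
        refine le_antisymm ?_ (le_level hjN.le hx)
        by_contra! hlt
        exact h (L.apply_of_le hlt (L.apply_level x))
      have hpar : parent ℓ N x = ℓ (j + 1) v := by rw [parent, hlev, hnest]
      have hxr : x ≠ r := by
        rintro rfl
        exact h (L.apply_of_le hjN (L.top N le_rfl x))
      have hadj := parentGraph_adj_parent L.level_lt_level_parent hxr
      have hmin := L.level_lt_level_parent x hxr
      rw [hpar] at hadj hmin
      refine ⟨q.concat hadj, ?_⟩
      rw [SimpleGraph.Walk.edges_concat, List.concat_eq_append, List.map_append,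
        List.sum_append, List.map_singleton, List.sum_singleton, levelWeight_mk,
        min_eq_left hmin.le, hlev]
      linarith

theorem wDist_le (L : LeaderSystem ℓ r N) {j : ℕ} {u v : W} (h : ℓ j u = ℓ j v) :
    wDist (parentGraph (parent ℓ N)) (levelWeight (level ℓ N)) u v ≤ 2 * 2 ^ j := by
  obtain ⟨q₁, h₁⟩ := L.exists_walk_leader j u
  obtain ⟨q₂, h₂⟩ := L.exists_walk_leader j v
  refine (wDist_le_of_walk levelWeight_nonneg
    ((q₁.copy rfl h).append q₂.reverse)).trans ?_
  rw [SimpleGraph.Walk.edges_append, List.map_append, List.sum_append,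
    SimpleGraph.Walk.edges_copy, SimpleGraph.Walk.edges_reverse, List.map_reverse,
    List.sum_reverse]
  linarith

theorem dist_le_levelWeight (L : LeaderSystem ℓ r N) {d : W → W → ℝ}
    (symm : ∀ u v, d u v = d v u) (hd : ∀ j < N, ∀ v, d v (ℓ (j + 1) v) ≤ 2 ^ j)
    (a b : W) (hab : (parentGraph (parent ℓ N)).Adj a b) :
    d a b ≤ levelWeight (level ℓ N) s(a, b) := by
  have key : ∀ v, v ≠ parent ℓ N v →
      d v (parent ℓ N v) ≤ levelWeight (level ℓ N) s(v, parent ℓ N v) := by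
    intro v hv
    have hvr : v ≠ r := by
      rintro rfl
      exact hv L.parent_root.symm
    rw [levelWeight_mk, min_eq_left (L.level_lt_level_parent v hvr).le]
    exact hd _ (L.level_lt hvr) v
  obtain ⟨hne, rfl | rfl⟩ := parentGraph_adj.1 hab
  · exact key a hne
  · rw [symm, Sym2.eq_swap]
    exact key b hne.symm

end LeaderSystem

theorem exists_leaderSystem {W : Type*} [Finite W] (r : W) (N : ℕ) (ρ : ℕ → Setoid W)
    (mono : ∀ j, ρ j ≤ ρ (j + 1)) (zero : ρ 0 = ⊥) (top : ∀ j, N ≤ j → ρ j = ⊤) :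
    ∃ ℓ : ℕ → W → W, LeaderSystem ℓ r N ∧ (∀ j v, ρ j v (ℓ j v)) ∧
      ∀ j u v, ρ j u v → ℓ j u = ℓ j v := by
  classical
  obtain ⟨n, ⟨e⟩⟩ := Finite.exists_equiv_fin W
  let f : W → ℕ := fun v => if v = r then 0 else e v + 1
  have f_inj : Function.Injective f := by
    intro u v h
    by_cases hu : u = r <;> by_cases hv : v = r <;> simp [f, hu, hv] at h ⊢
    exact e.injective (Fin.ext h)
  have ex : ∀ j v, ∃ x, ρ j v x ∧ ∀ y, ρ j v y → f x ≤ f y := fun j v =>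
    Set.exists_min_image {x | ρ j v x} f (Set.toFinite _) ⟨v, (ρ j).refl v⟩
  choose ℓ hℓ hmin using ex
  have uniq : ∀ j v x, ρ j v x → (∀ y, ρ j v y → f x ≤ f y) → ℓ j v = x :=
    fun j v x hx h => f_inj (le_antisymm (hmin j v x hx) (h _ (hℓ j v)))
  have congr : ∀ j u v, ρ j u v → ℓ j u = ℓ j v := fun j u v h =>
    uniq j u _ ((ρ j).trans h (hℓ j v)) fun y hy =>
      hmin j v y ((ρ j).trans ((ρ j).symm h) hy)
  refine ⟨ℓ, ⟨fun v => ?_, fun j hj v => ?_, fun j v => ?_, fun j v => ?_, fun j v h => ?_⟩,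
    hℓ, congr⟩
  · have := hℓ 0 v
    rw [zero] at this
    exact this.symm
  · refine uniq j v r ?_ fun y _ => by simp [f]
    rw [top j hj]
    trivial
  · exact (congr j _ _ (hℓ j v)).symm
  · exact (congr (j + 1) _ _ (mono j (hℓ j v))).symm
  · refine uniq j v v ((ρ j).refl v) fun y hy => ?_
    have := hmin (j + 1) v y (mono j hy)
    rwa [h] at this

namespace HierDecomp

variable {V : Type*} {d : V → V → ℝ}

/-- The relation of lying in a common part at level `min i h`. -/
def levelSetoid (H : HierDecomp V d) (i : ℕ) : Setoid V :=
  Setoid.mkClasses (H.P (min i H.h)) (H.partition _ (min_le_right _ _)).2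

theorem levelSetoid_iff (H : HierDecomp V d) {i : ℕ} {u v : V} :
    H.levelSetoid i u v ↔ ∃ p ∈ H.P (min i H.h), u ∈ p ∧ v ∈ p := by
  have hp := (H.partition (min i H.h) (min_le_right _ _)).2
  obtain ⟨q, ⟨hq, hu⟩, -⟩ := hp u
  constructor
  · exact fun h => ⟨q, hq, hu, h q hq hu⟩
  · rintro ⟨p, hpp, hup, hvp⟩ s hs hus
    rwa [(hp u).unique ⟨hs, hus⟩ ⟨hpp, hup⟩]

theorem levelSetoid_mono (H : HierDecomp V d) (i : ℕ) :
    H.levelSetoid i ≤ H.levelSetoid (i + 1) := by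
  intro u v huv
  rw [levelSetoid_iff] at huv ⊢
  obtain ⟨p, hp, hu, hv⟩ := huv
  rcases lt_or_ge i H.h with hi | hi
  · rw [min_eq_left hi.le] at hp
    obtain ⟨q, hq, hpq⟩ := H.refines i hi p hp
    exact ⟨q, by rwa [min_eq_left (Nat.succ_le_of_lt hi)], hpq hu, hpq hv⟩
  · rw [min_eq_right hi] at hp
    exact ⟨p, by rwa [min_eq_right (hi.trans i.le_succ)], hu, hv⟩

theorem levelSetoid_top (H : HierDecomp V d) {i : ℕ} (hi : H.h ≤ i) :
    H.levelSetoid i = ⊤ := by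
  refine top_unique fun u v _ => ?_
  rw [levelSetoid_iff, min_eq_right hi, H.top]
  exact ⟨_, rfl, trivial, trivial⟩

theorem dist_le_of_levelSetoid (H : HierDecomp V d) {i : ℕ} (hi : i ≤ H.h) {u v : V}
    (h : H.levelSetoid i u v) : d u v ≤ 2 ^ i := by
  rw [levelSetoid_iff, min_eq_left hi] at h
  obtain ⟨p, hp, hu, hv⟩ := h
  exact H.part_diam i hi p hp u hu v hv

theorem Padded.lt_dist {H : HierDecomp V d} {α : ℝ} {u v : V} (hu : H.Padded α u)
    (hα : 0 ≤ α) (h0 : d u u = 0) {i : ℕ} (h : ¬ H.levelSetoid i u v) :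
    α * 2 ^ i < d u v := by
  by_contra! hle
  refine h ?_
  rcases le_total H.h i with hi | hi
  · rw [H.levelSetoid_top hi]
    trivial
  · obtain ⟨p, hp, hsub⟩ := hu i hi
    rw [levelSetoid_iff, min_eq_left hi]
    exact ⟨p, hp, hsub (by rw [Set.mem_ofPred_eq, h0]; positivity), hsub hle⟩

end HierDecomp

/-- There is a universal constant `C` such that: given a hierarchical
decomposition `H` of a finite metric `(V, d)` with all distances at least `1` and a root
`r` that is `α`-padded in `H`, there is a `(C/α)`-partial tree embedding of `(V, d)`
rooted at `r` whose vertex set is exactly the set of `α`-padded nodes. -/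
theorem partialTreeEmbedding_of_padded :
    ∃ C : ℝ, 0 < C ∧
      ∀ (V : Type) [Fintype V], ∀ d : V → V → ℝ,
        (∀ u v : V, d u v = d v u) →
        (∀ u v x : V, d u x ≤ d u v + d v x) →
        (∀ u v : V, d u v = 0 ↔ u = v) →
        (∀ u v : V, u ≠ v → 1 ≤ d u v) →
        ∀ (H : HierDecomp V d) (r : V) (α : ℝ), 0 < α → α ≤ 1 → H.Padded α r →
        ∃ emb : PartialTreeEmbedding V d (C / α),
          emb.verts = {v : V | H.Padded α v} ∧ (emb.root : V) = r := by
  refine ⟨8, by norm_num, ?_⟩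
  intro V _ d symm tri eq0 sep H r α hα hα1 hr
  have h0 : ∀ u, d u u = 0 := fun u => (eq0 u u).2 rfl
  let W := {v : V | H.Padded α v}
  let root : W := ⟨r, hr⟩
  let ρ : ℕ → Setoid W := fun j => j.casesOn ⊥ fun i => (H.levelSetoid i).comap Subtype.val
  obtain ⟨ℓ, L, hℓ, hcongr⟩ := exists_leaderSystem root (H.h + 1) ρ
    (by
      rintro (_ | i)
      · exact bot_le
      · exact fun u v h => H.levelSetoid_mono i h)
    rfl
    (by
      rintro (_ | i) hi
      · omega
      · refine top_unique fun u v _ => ?_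
        change H.levelSetoid i u v
        rw [H.levelSetoid_top (by omega)]
        trivial)
  have htree := parentGraph_isTree LeaderSystem.level_le L.level_lt_level_parent L.parent_root
  refine ⟨⟨W, parentGraph (LeaderSystem.parent ℓ (H.h + 1)), htree,
    levelWeight (LeaderSystem.level ℓ (H.h + 1)), root,
    wellSeparated_parentGraph LeaderSystem.level_le L.level_lt_level_parent L.parent_root,
    ?_, ?_⟩, rfl, rfl⟩
  · refine le_wDist (d := fun u v : W => d u v) htree.connected (fun u => h0 u)
      (fun u v x => tri u v x) ?_
    exact L.dist_le_levelWeight (fun u v => symm u v) fun j hj v =>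
      H.dist_le_of_levelSetoid (Nat.le_of_lt_succ hj) (hℓ (j + 1) v)
  · intro u v
    by_cases huv : u = v
    · subst huv
      rw [h0, mul_zero]
      exact (wDist_le_of_walk levelWeight_nonneg SimpleGraph.Walk.nil).trans (by simp)
    have hne : (u : V) ≠ v := fun h => huv (Subtype.ext h)
    suffices ∃ j, ρ j u v ∧ α * 2 ^ j ≤ 4 * d u v by
      obtain ⟨j, hj, hd⟩ := this
      refine (L.wDist_le (hcongr j u v hj)).trans ?_
      rw [div_mul_eq_mul_div, le_div_iff₀ hα]
      linarith
    have ex : ∃ i, H.levelSetoid i u v := ⟨H.h, by rw [H.levelSetoid_top le_rfl]; trivial⟩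
    classical
    refine ⟨Nat.find ex + 1, Nat.find_spec ex, ?_⟩
    rcases hi : Nat.find ex with _ | i
    · rw [zero_add, pow_one]
      linarith [sep u v hne]
    · have hlt := u.2.lt_dist hα.le (h0 u) (Nat.find_min ex (m := i) (by omega))
      rw [pow_succ, pow_succ]
      linarith
end
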